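/- Let R = S ×_k T be a non-trivial fiber product and assume depth(S) = 0 or depth(T) = 0. For finitely generated R-modules M and N, the following conditions are equivalent: (i) Tor_i^R(M,N) = 0 for all sufficiently large i; (ii) Tor_i^R(M,N) = 0 for all i ≥ 1; (iii) Tor_i^R(M,N) = 0 for some i ≥ 5; (iv) M has finite projective dimension over R or N has finite projective dimension over R; (v) M is free over R or N is free over R. -/

import Mathlib

open CategoryTheory Opposite IsLocalRing

noncomputable section

/-- Vanishing of `Tor_i^A(M, N)`. -/
abbrev TorZero (A : Type) [CommRing A] (M N : Type) [AddCommGroup M] [Module A M]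
    [AddCommGroup N] [Module A N] (i : ℕ) : Prop :=
  Subsingleton (((Tor (ModuleCat A) i).obj (ModuleCat.of A M)).obj (ModuleCat.of A N))

/-- Vanishing of `Ext^i_A(M, N)`. -/
abbrev ExtZero (A : Type) [CommRing A] (M N : Type) [AddCommGroup M] [Module A M]
    [AddCommGroup N] [Module A N] (i : ℕ) : Prop :=
  Subsingleton (((Ext A (ModuleCat A) i).obj (op (ModuleCat.of A M))).obj (ModuleCat.of A N))

/-- `M` has projective dimension at most `n` over `A`:
`Ext^i_A(M, -) = 0` for all `i > n`. -/
def PdLE (A : Type) [CommRing A] (M : Type) [AddCommGroup M] [Module A M] (n : ℕ) : Prop :=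
  ∀ (N : ModuleCat A) (i : ℕ), n < i →
    Subsingleton (((Ext A (ModuleCat A) i).obj (op (ModuleCat.of A M))).obj N)

/-- `N` has injective dimension at most `n` over `A`:
`Ext^i_A(-, N) = 0` for all `i > n`. -/
def IdLE (A : Type) [CommRing A] (N : Type) [AddCommGroup N] [Module A N] (n : ℕ) : Prop :=
  ∀ (X : ModuleCat A) (i : ℕ), n < i →
    Subsingleton (((Ext A (ModuleCat A) i).obj (op X)).obj (ModuleCat.of A N))

/-- The depth of a module over a noetherian local ring, as an extended natural number:
`inf { i | Ext^i_A(k, M) ≠ 0 }`. -/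
def depthM (A : Type) [CommRing A] [IsLocalRing A] (M : Type) [AddCommGroup M]
    [Module A M] : ℕ∞ :=
  sInf {n : ℕ∞ | ∃ i : ℕ, n = i ∧
    ¬ Subsingleton (((Ext A (ModuleCat A) i).obj
        (op (ModuleCat.of A (A ⧸ maximalIdeal A)))).obj (ModuleCat.of A M))}

/-- The fiber product `S ×ₖ T` as a subring of `S × T`. -/
def fiberProd {S T k : Type} [CommRing S] [CommRing T] [CommRing k]
    (πS : S →+* k) (πT : T →+* k) : Subring (S × T) :=
  RingHom.eqLocus (πS.comp (RingHom.fst S T)) (πT.comp (RingHom.snd S T))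

/-- A resolution of `M` by free `R`-modules of finite rank. -/
structure FreeRes (R M : Type) [CommRing R] [AddCommGroup M] [Module R M] where
  r : ℕ → ℕ
  d : ∀ i, (Fin (r (i + 1)) → R) →ₗ[R] (Fin (r i) → R)
  ε : (Fin (r 0) → R) →ₗ[R] M
  surj : Function.Surjective ε
  exact_zero : Function.Exact (d 0) ε
  exact_succ : ∀ i, Function.Exact (d (i + 1)) (d i)

namespace FreeRes

variable {R M : Type} [CommRing R] [AddCommGroup M] [Module R M] (F : FreeRes R M)

/-- The chain complex underlying a free resolution. -/
def complex : ChainComplex (ModuleCat R) ℕ :=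
  ChainComplex.of (fun i => ModuleCat.of R (Fin (F.r i) → R)) (fun i => ModuleCat.ofHom (F.d i))
    (fun i => by
      rw [← ModuleCat.ofHom_comp, (F.exact_succ i).linearMap_comp_eq_zero]
      rfl)

lemma complex_d (i : ℕ) : F.complex.d (i + 1) i = ModuleCat.ofHom (F.d i) :=
  ChainComplex.of_d (fun i => ModuleCat.of R (Fin (F.r i) → R)) (fun i => ModuleCat.ofHom (F.d i)) i

lemma complex_exactAt_succ (i : ℕ) : F.complex.ExactAt (i + 1) := by
  rw [HomologicalComplex.exactAt_iff' _ (i + 1 + 1) (i + 1) i (by simp) (by simp),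
    ShortComplex.moduleCat_exact_iff_range_eq_ker]
  change LinearMap.range (F.complex.d (i + 1 + 1) (i + 1)).hom =
    LinearMap.ker (F.complex.d (i + 1) i).hom
  rw [complex_d, complex_d]
  exact (LinearMap.exact_iff.1 (F.exact_succ i)).symm

/-- A free resolution as a projective resolution in `ModuleCat R`. -/
def toProjectiveResolution : ProjectiveResolution (ModuleCat.of R M) where
  complex := F.complex
  projective n := ModuleCat.projective_of_free (Pi.basisFun R (Fin (F.r n)))
  π := (ChainComplex.toSingle₀Equiv _ _).symm ⟨ModuleCat.ofHom F.ε, by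
    rw [complex_d]
    refine (ModuleCat.ofHom_comp _ _).symm.trans ?_
    rw [F.exact_zero.linearMap_comp_eq_zero]
    rfl⟩
  quasiIso := ⟨fun n => by
    cases n with
    | zero =>
      rw [ChainComplex.quasiIsoAt₀_iff, ShortComplex.quasiIso_iff_of_zeros' _ rfl rfl rfl]
      refine (ShortComplex.exact_and_epi_g_iff_of_iso
        (S₂ := ShortComplex.mk (ModuleCat.ofHom (F.d 0)) (ModuleCat.ofHom F.ε) (by
          rw [← ModuleCat.ofHom_comp, F.exact_zero.linearMap_comp_eq_zero]; rfl)) ?_).2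
        ⟨?_, ?_⟩
      · refine ShortComplex.isoMk (Iso.refl _) (Iso.refl _) (Iso.refl _) ?_ ?_
        · exact (Category.id_comp _).trans ((F.complex_d 0).symm.trans (Category.comp_id _).symm)
        · simp
          rfl
      · rw [ShortComplex.moduleCat_exact_iff_range_eq_ker]
        exact (LinearMap.exact_iff.1 F.exact_zero).symm
      · exact (ModuleCat.epi_iff_surjective _).2 F.surj
    | succ n =>
      rw [quasiIsoAt_iff_exactAt']
      · apply complex_exactAt_succ
      · apply ChainComplex.exactAt_succ_single_obj⟩

open TensorProduct

lemma torZero_succ_iff (X : Type) [AddCommGroup X] [Module R X] (i : ℕ) :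
    TorZero R X M (i + 1) ↔
      Function.Exact ((F.d (i + 1)).lTensor X) ((F.d i).lTensor X) := by
  have e := F.toProjectiveResolution.isoLeftDerivedObj
    ((MonoidalCategory.tensoringLeft (ModuleCat R)).obj (ModuleCat.of R X)) (i + 1)
  rw [TorZero, ← ModuleCat.isZero_iff_subsingleton]
  refine (Iso.isZero_iff e).trans ?_
  refine (HomologicalComplex.exactAt_iff_isZero_homology _ _).symm.trans ?_
  rw [HomologicalComplex.exactAt_iff' _ (i + 1 + 1) (i + 1) i (by simp) (by simp),
    ShortComplex.moduleCat_exact_iff_range_eq_ker, LinearMap.exact_iff, eq_comm]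
  have h (j : ℕ) : (((MonoidalCategory.tensoringLeft (ModuleCat R)).obj (ModuleCat.of R X)).map
    (F.complex.d (j+1) j)).hom = (F.d j).lTensor X := by
    rw [complex_d]; rfl
  rw [← h, ← h]
  rfl

lemma exists_factor_of_extZero (X : Type) [AddCommGroup X] [Module R X] (i : ℕ)
    (h : Subsingleton (((Ext R (ModuleCat R) (i + 1)).obj
        (op (ModuleCat.of R M))).obj (ModuleCat.of R X)))
    (f : (Fin (F.r (i + 1)) → R) →ₗ[R] X) (hf : f ∘ₗ F.d (i + 1) = 0) :
    ∃ g, f = g ∘ₗ F.d i := by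
  have e := F.toProjectiveResolution.isoExt (R := R) (i+1) (ModuleCat.of R X)
  rw [← ModuleCat.isZero_iff_subsingleton] at h
  replace h := (Iso.isZero_iff e).1 h
  replace h := (HomologicalComplex.exactAt_iff_isZero_homology _ _).2 h
  rw [HomologicalComplex.exactAt_iff' _ i (i + 1) (i+1+1) (by simp) (by simp),
    ShortComplex.moduleCat_exact_iff] at h
  obtain ⟨g, hg⟩ := h (ModuleCat.ofHom f) (by
    change F.complex.d (i + 1 + 1) (i + 1) ≫ ModuleCat.ofHom f = 0
    rw [complex_d]
    refine (ModuleCat.ofHom_comp _ _).symm.trans ?_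
    rw [hf]; rfl)
  change F.complex.d (i + 1) i ≫ g = ModuleCat.ofHom f at hg
  rw [complex_d] at hg
  exact ⟨g.hom, (congrArg ModuleCat.Hom.hom hg).symm⟩

end FreeRes
lemma subsingleton_ext_zero (R M X : Type) [CommRing R] [AddCommGroup M] [Module R M] [AddCommGroup X]
    [Module R X] (h : Subsingleton (M →ₗ[R] X)) :
    Subsingleton (((Ext R (ModuleCat R) 0).obj
        (op (ModuleCat.of R M))).obj (ModuleCat.of R X)) := by
  rw [← ModuleCat.isZero_iff_subsingleton]
  let P := ProjectiveResolution.of (ModuleCat.of R M)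
  refine (Iso.isZero_iff (P.isoExt (R := R) 0 (ModuleCat.of R X))).2 ?_
  refine (HomologicalComplex.exactAt_iff_isZero_homology _ _).1 ?_
  rw [HomologicalComplex.exactAt_iff' _ 0 0 1 (by simp) (by simp),
    ShortComplex.moduleCat_exact_iff]
  intro f hf
  change P.complex.d 1 0 ≫ f = 0 at hf
  refine ⟨0, ?_⟩
  rw [map_zero]
  have h1 := P.exact₀
  have : Epi (P.π.f 0) := inferInstance
  let u : ModuleCat.of R M ⟶ ModuleCat.of R X := h1.desc f hf
  have hu : u = 0 := ModuleCat.hom_ext (Subsingleton.elim _ _)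
  have h2 : P.π.f 0 ≫ u = f := h1.g_desc f hf
  rw [← h2, hu]
  exact Limits.comp_zero.symm

lemma exists_socle (S : Type) [CommRing S] [IsLocalRing S] (h : depthM S S = 0) :
    ∃ s : S, s ≠ 0 ∧ ∀ x ∈ maximalIdeal S, x * s = 0 := by
  have hne : {n : ℕ∞ | ∃ i : ℕ, n = i ∧
    ¬ Subsingleton (((Ext S (ModuleCat S) i).obj
        (op (ModuleCat.of S (S ⧸ maximalIdeal S)))).obj (ModuleCat.of S S))}.Nonempty := by
    by_contra hh
    rw [depthM, Set.not_nonempty_iff_eq_empty.1 hh] at h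
    simp at h
  have h0 := csInf_mem hne
  rw [← depthM, h] at h0
  obtain ⟨i, hi, hn⟩ := h0
  obtain rfl : i = 0 := by exact_mod_cast hi.symm
  by_contra! hc
  refine hn (subsingleton_ext_zero _ _ _ ⟨fun f g => ?_⟩)
  have key (f : (S ⧸ maximalIdeal S) →ₗ[S] S) : f = 0 := by
    ext
    by_contra h1
    obtain ⟨x, hx, hx'⟩ := hc _ h1
    apply hx'
    change x • f (Ideal.Quotient.mk _ 1) = 0
    rw [← map_smul, ← map_zero f]
    congr 1
    change Ideal.Quotient.mk _ (x * 1) = 0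
    rw [mul_one]
    exact Ideal.Quotient.eq_zero_iff_mem.2 hx
  rw [key f, key g]

open TensorProduct

theorem exists_minimal_cover (R M : Type) [CommRing R] [IsLocalRing R] [AddCommGroup M] [Module R M]
    [Module.Finite R M] : ∃ (n : ℕ) (f : (Fin n → R) →ₗ[R] M), Function.Surjective f ∧
      ∀ x, f x = 0 → ∀ i, x i ∈ maximalIdeal R := by
  let b := Module.finBasis (ResidueField R) (TensorProduct R (ResidueField R) M)
  have hsurj (i) : ∃ m : M, 1 ⊗ₜ[R] m = b i :=
    TensorProduct.mk_surjective _ _ _ Ideal.Quotient.mk_surjective (b i)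
  choose v hv using hsurj
  refine ⟨_, Fintype.linearCombination R v, ?_, fun x hx i => ?_⟩
  · rw [← LinearMap.range_eq_top, Fintype.range_linearCombination]
    exact IsLocalRing.span_eq_top_of_tmul_eq_basis v b hv
  · have h := congrArg (TensorProduct.mk R (ResidueField R) M 1) hx
    rw [Fintype.linearCombination_apply, map_sum, map_zero] at h
    have h2 : ∑ i, residue R (x i) • b i = 0 := by
      rw [← h]
      refine Finset.sum_congr rfl fun i _ => ?_
      rw [← hv, map_smul]
      exact algebraMap_smul _ _ _
    have h3 := Fintype.linearIndependent_iff.1 b.linearIndependent _ h2 i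
    exact (residue_eq_zero_iff _).1 h3

namespace FreeRes

section Construction

variable (R : Type) [CommRing R] [IsLocalRing R] (M : Type) [AddCommGroup M] [Module R M]
  [Module.Finite R M]

/-- The number of generators in a chosen minimal cover of `M`. -/
def coverRank : ℕ := (exists_minimal_cover R M).choose

/-- A surjection onto `M` from a free module whose kernel has entries in the maximal ideal. -/
def cover : (Fin (coverRank R M) → R) →ₗ[R] M := (exists_minimal_cover R M).choose_spec.choose

lemma cover_surjective : Function.Surjective (cover R M) :=
  (exists_minimal_cover R M).choose_spec.choose_spec.1

lemma mem_maximalIdeal_of_cover_eq_zero {x : Fin (coverRank R M) → R} (hx : cover R M x = 0)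
    (i : Fin (coverRank R M)) : x i ∈ maximalIdeal R :=
  (exists_minimal_cover R M).choose_spec.choose_spec.2 x hx i

lemma range_subtype_comp_cover {n : ℕ} (K : Submodule R (Fin n → R)) [Module.Finite R K] :
    LinearMap.range (K.subtype ∘ₗ cover R K) = K := by
  rw [LinearMap.range_comp_of_range_eq_top _ (LinearMap.range_eq_top.2 (cover_surjective R K)),
    Submodule.range_subtype]

lemma ker_subtype_comp_cover {n : ℕ} (K : Submodule R (Fin n → R)) [Module.Finite R K] :
    LinearMap.ker (K.subtype ∘ₗ cover R K) = LinearMap.ker (cover R K) :=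
  LinearMap.ker_comp_of_ker_eq_bot _ (Submodule.ker_subtype _)

variable [IsNoetherianRing R]

/-- The iterated kernels of minimal covers. -/
def minimalSyzygy : ℕ → Σ n : ℕ, Submodule R (Fin n → R)
  | 0 => ⟨coverRank R M, LinearMap.ker (cover R M)⟩
  | n + 1 => ⟨coverRank R (minimalSyzygy n).2, LinearMap.ker (cover R (minimalSyzygy n).2)⟩

/-- A minimal free resolution of `M`. -/
def minimal : FreeRes R M where
  r i := (minimalSyzygy R M i).1
  d i := (minimalSyzygy R M i).2.subtype ∘ₗ cover R (minimalSyzygy R M i).2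
  ε := cover R M
  surj := cover_surjective R M
  exact_zero := LinearMap.exact_iff.2 (range_subtype_comp_cover R (minimalSyzygy R M 0).2).symm
  exact_succ i := LinearMap.exact_iff.2 <|
    (ker_subtype_comp_cover R (minimalSyzygy R M i).2).trans
      (range_subtype_comp_cover R (minimalSyzygy R M (i + 1)).2).symm

lemma minimal_range (i : ℕ) :
    LinearMap.range ((minimal R M).d i) = (minimalSyzygy R M i).2 :=
  range_subtype_comp_cover R (minimalSyzygy R M i).2

lemma minimal_apply_mem (i : ℕ) (x : Fin ((minimal R M).r (i + 1)) → R)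
    (j : Fin ((minimal R M).r i)) : (minimal R M).d i x j ∈ maximalIdeal R := by
  have hx : (minimal R M).d i x ∈ (minimalSyzygy R M i).2 :=
    minimal_range R M i ▸ LinearMap.mem_range_self _ x
  cases i with
  | zero => exact mem_maximalIdeal_of_cover_eq_zero R M hx j
  | succ i => exact mem_maximalIdeal_of_cover_eq_zero R (minimalSyzygy R M i).2 hx j

end Construction

end FreeRes

section Coord

variable {R : Type} [CommRing R]

/-- The vectors of length `n` with all entries in `I`. -/
def coord (I : Ideal R) (n : ℕ) : Submodule R (Fin n → R) :=
  Submodule.pi Set.univ fun _ => I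

lemma mem_coord {I : Ideal R} {n : ℕ} {x : Fin n → R} : x ∈ coord I n ↔ ∀ i, x i ∈ I := by
  simp [coord]

lemma map_mem_smul_of_mem_coord {M : Type} [AddCommGroup M] [Module R M] {I : Ideal R} {n : ℕ}
    (f : (Fin n → R) →ₗ[R] M) {x : Fin n → R} (hx : x ∈ coord I n) :
    f x ∈ I • LinearMap.range f := by
  rw [pi_eq_sum_univ' x, map_sum]
  refine Submodule.sum_mem _ fun i _ => ?_
  rw [map_smul]
  exact Submodule.smul_mem_smul (mem_coord.1 hx i) (LinearMap.mem_range_self f _)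

lemma map_mem_coord {I : Ideal R} {n p : ℕ}
    (f : (Fin n → R) →ₗ[R] (Fin p → R)) {x : Fin n → R} (hx : x ∈ coord I n) :
    f x ∈ coord I p := by
  refine (Submodule.smul_le.2 fun r hr y _ => ?_) (map_mem_smul_of_mem_coord f hx)
  exact mem_coord.2 fun i => I.mul_mem_right _ hr

lemma coord_inf_eq_bot {a b : Ideal R} (h : a ⊓ b = ⊥) (n : ℕ) : coord a n ⊓ coord b n = ⊥ := by
  rw [eq_bot_iff]
  rintro x ⟨ha, hb⟩
  ext i
  have : x i ∈ a ⊓ b := ⟨mem_coord.1 ha i, mem_coord.1 hb i⟩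
  rw [h] at this
  exact this

lemma smul_eq_zero_of_mem_coord {a b : Ideal R} (h : a ⊓ b = ⊥) {n : ℕ} {r : R} (hr : r ∈ a)
    {x : Fin n → R} (hx : x ∈ coord b n) : r • x = 0 := by
  ext i
  have : r * x i ∈ a ⊓ b := ⟨a.mul_mem_right _ hr, b.mul_mem_left _ (mem_coord.1 hx i)⟩
  rw [h] at this
  exact this

end Coord

section Local

variable {R : Type} [CommRing R] [IsLocalRing R]

lemma ker_le_split {a b : Ideal R} (hab : a ⊓ b = ⊥) (hm : a ⊔ b = maximalIdeal R) {n p : ℕ}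
    (f : (Fin n → R) →ₗ[R] (Fin p → R)) (hf : LinearMap.ker f ≤ coord (maximalIdeal R) n) :
    LinearMap.ker f ≤ (LinearMap.ker f ⊓ coord a n) ⊔ (LinearMap.ker f ⊓ coord b n) := by
  intro x hx
  have h (i) : ∃ y ∈ a, ∃ z ∈ b, y + z = x i := by
    rw [← Submodule.mem_sup, hm]
    exact mem_coord.1 (hf hx) i
  choose y hy z hz hyz using h
  have hxyz : y + z = x := funext hyz
  have hya : y ∈ coord a n := mem_coord.2 hy
  have hzb : z ∈ coord b n := mem_coord.2 hz
  have hsum : f y = - f z := by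
    rw [eq_neg_iff_add_eq_zero, ← map_add, hxyz]
    exact hx
  have hfy : f y ∈ coord a p ⊓ coord b p :=
    ⟨map_mem_coord f hya, hsum ▸ neg_mem (map_mem_coord f hzb)⟩
  rw [coord_inf_eq_bot hab, Submodule.mem_bot] at hfy
  have hfz : f z = 0 := by rwa [hfy, eq_comm, neg_eq_zero] at hsum
  exact Submodule.mem_sup.2 ⟨y, ⟨hfy, hya⟩, z, ⟨hfz, hzb⟩, hxyz⟩

lemma eq_bot_of_le_smul {M : Type} [AddCommGroup M] [Module R M] [IsNoetherian R M]
    {K : Submodule R M} (h : K ≤ maximalIdeal R • K) : K = ⊥ :=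
  Submodule.eq_bot_of_le_smul_of_le_jacobson_bot _ _ (IsNoetherian.noetherian K) h
    (IsLocalRing.maximalIdeal_le_jacobson _)

lemma exists_residueField_ne_zero {M : Type} [AddCommGroup M] [Module R M]
    {K : Submodule R M} (x : K) (hx : (x : M) ∉ maximalIdeal R • K) :
    ∃ f : K →ₗ[R] ResidueField R, f x ≠ 0 := by
  have hx' : x ∉ maximalIdeal R • (⊤ : Submodule R K) := by
    intro h
    have := Submodule.mem_map_of_mem (f := K.subtype) h
    rw [Submodule.map_smul'', Submodule.map_top, Submodule.range_subtype] at this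
    exact hx this
  let _ : Module (ResidueField R) (K ⧸ (maximalIdeal R • (⊤ : Submodule R K))) :=
    (inferInstance : Module (R ⧸ maximalIdeal R) (K ⧸ (maximalIdeal R • (⊤ : Submodule R K))))
  have : IsScalarTower R (ResidueField R) (K ⧸ (maximalIdeal R • (⊤ : Submodule R K))) :=
    (inferInstance : IsScalarTower R (R ⧸ maximalIdeal R) _)
  let q : K →ₗ[R] K ⧸ (maximalIdeal R • (⊤ : Submodule R K)) := Submodule.mkQ _
  have hq : q x ≠ 0 := fun h => hx' ((Submodule.Quotient.mk_eq_zero _).1 h)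
  by_contra! hc
  refine hq ((Module.forall_dual_apply_eq_zero_iff (ResidueField R) (q x)).1 fun g => ?_)
  exact hc (g.restrictScalars R ∘ₗ q)

variable [IsNoetherianRing R]

lemma inf_coord_eq_bot_of_le_smul {a b : Ideal R} (hab : a ⊓ b = ⊥) {n : ℕ}
    {K : Submodule R (Fin n → R)} (hK : K ≤ (K ⊓ coord a n) ⊔ (K ⊓ coord b n))
    (h : K ⊓ coord a n ≤ maximalIdeal R • K) : K ⊓ coord a n = ⊥ := by
  refine eq_bot_of_le_smul fun x hx => ?_
  have hx' := smul_mono_right (maximalIdeal R) hK (h hx)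
  rw [Submodule.smul_sup] at hx'
  obtain ⟨u, hu, v, hv, huv⟩ := Submodule.mem_sup.1 hx'
  have hv0 : v ∈ coord a n ⊓ coord b n := by
    refine ⟨?_, (Submodule.smul_le_right hv).2⟩
    rw [← eq_sub_iff_add_eq'] at huv
    rw [huv]
    exact sub_mem hx.2 (Submodule.smul_le_right hu).2
  rw [coord_inf_eq_bot hab, Submodule.mem_bot] at hv0
  rwa [← huv, hv0, add_zero]

end Local

namespace FreeRes

variable {R : Type} [CommRing R]

section Shift

variable {M A G B : Type} [AddCommGroup M] [Module R M] [AddCommGroup A] [Module R A]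
  [AddCommGroup G] [Module R G] [AddCommGroup B] [Module R B]

/-- `Tor_{i+1}(X, M) = 0`, expressed through the free resolution `F` of `M`. -/
def TorExact (F : FreeRes R M) (X : Type) [AddCommGroup X] [Module R X] (i : ℕ) : Prop :=
  Function.Exact ((F.d (i + 1)).lTensor X) ((F.d i).lTensor X)

lemma torExact_of_flat (F : FreeRes R M) [Module.Flat R G] (i : ℕ) : F.TorExact G i :=
  Module.Flat.lTensor_exact G (F.exact_succ i)

lemma TorExact.shift {F : FreeRes R M} [Module.Flat R G] {f : A →ₗ[R] G} {g : G →ₗ[R] B}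
    (hf : Function.Injective f) (hfg : Function.Exact f g) (hg : Function.Surjective g) {i : ℕ}
    (h : F.TorExact B (i + 1)) : F.TorExact A i := by
  have comm {X Y : Type} [AddCommGroup X] [Module R X] [AddCommGroup Y] [Module R Y]
      (φ : X →ₗ[R] Y) (j : ℕ) (x : X ⊗[R] (Fin (F.r (j + 1)) → R)) :
      (F.d j).lTensor Y (φ.rTensor _ x) = φ.rTensor _ ((F.d j).lTensor X x) := by
    rw [← LinearMap.comp_apply, ← LinearMap.comp_apply, LinearMap.lTensor_comp_rTensor,
      LinearMap.rTensor_comp_lTensor]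
  have dd {X : Type} [AddCommGroup X] [Module R X] (j : ℕ)
      (x : X ⊗[R] (Fin (F.r (j + 2)) → R)) :
      (F.d j).lTensor X ((F.d (j + 1)).lTensor X x) = 0 := by
    rw [← LinearMap.comp_apply, ← LinearMap.lTensor_comp,
      (F.exact_succ j).linearMap_comp_eq_zero, LinearMap.lTensor_zero, LinearMap.zero_apply]
  have ex (j : ℕ) := rTensor_exact (Fin (F.r j) → R) hfg hg
  have surj (j : ℕ) := LinearMap.rTensor_surjective (Fin (F.r j) → R) hg
  intro z
  refine ⟨fun hz => ?_, ?_⟩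
  · obtain ⟨w, hw⟩ := (F.torExact_of_flat (G := G) i (f.rTensor _ z)).1 (by
      rw [comm, hz, map_zero])
    obtain ⟨v, hv⟩ := (h (g.rTensor _ w)).1 (by
      rw [comm, hw, (ex _).apply_apply_eq_zero])
    obtain ⟨v, rfl⟩ := surj _ v
    obtain ⟨u, hu⟩ := (ex _ (w - (F.d (i + 1 + 1)).lTensor G v)).1 (by
      rw [map_sub, ← comm, hv, sub_self])
    refine ⟨u, Module.Flat.rTensor_preserves_injective_linearMap f hf ?_⟩
    rw [← comm, hu, map_sub, dd, sub_zero, hw]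
  · rintro ⟨u, rfl⟩
    exact dd i u

end Shift

variable {M N : Type} [AddCommGroup M] [Module R M] [AddCommGroup N] [Module R N]

/-- The `(i + 1)`-st syzygy module of a free resolution. -/
abbrev syz (F : FreeRes R M) (i : ℕ) : Submodule R (Fin (F.r i) → R) := LinearMap.range (F.d i)

lemma syz_succ (F : FreeRes R M) (i : ℕ) : F.syz (i + 1) = LinearMap.ker (F.d i) :=
  (LinearMap.exact_iff.1 (F.exact_succ i)).symm

lemma TorExact.syz_zero {F : FreeRes R N} (P : FreeRes R M) {i : ℕ}
    (h : F.TorExact M (i + 1)) : F.TorExact (P.syz 0) i := by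
  refine h.shift (f := (P.syz 0).subtype) (g := P.ε) Subtype.val_injective ?_ P.surj
  rw [LinearMap.exact_iff, Submodule.range_subtype]
  exact LinearMap.exact_iff.1 P.exact_zero

lemma TorExact.syz_succ {F : FreeRes R N} (P : FreeRes R M) {i j : ℕ}
    (h : F.TorExact (P.syz j) (i + 1)) : F.TorExact (P.syz (j + 1)) i := by
  refine h.shift (f := (P.syz (j + 1)).subtype) (g := (P.d j).rangeRestrict)
    Subtype.val_injective ?_ (P.d j).surjective_rangeRestrict
  rw [LinearMap.exact_iff, Submodule.range_subtype, LinearMap.ker_rangeRestrict, P.syz_succ]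

variable [IsLocalRing R]

lemma TorExact.mem_or_mem {F : FreeRes R N} {i n : ℕ} {K : Submodule R (Fin n → R)}
    (h : F.TorExact K i) {a b : Ideal R} (hab : a ⊓ b = ⊥) {x : Fin n → R} (hx : x ∈ K)
    (hxb : x ∈ coord b n) {l : Fin (F.r i) → R} (hl : l ∈ F.syz i) (hla : l ∈ coord a (F.r i)) :
    x ∈ maximalIdeal R • K ∨ l ∈ maximalIdeal R • F.syz i := by
  by_contra! hc
  obtain ⟨f, hf⟩ := exists_residueField_ne_zero (⟨x, hx⟩ : K) hc.1
  obtain ⟨g, hg⟩ := exists_residueField_ne_zero (⟨l, hl⟩ : F.syz i) hc.2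
  obtain ⟨p, rfl⟩ := hl
  have hcycle : (F.d i).lTensor K ((⟨x, hx⟩ : K) ⊗ₜ p) = 0 := by
    rw [LinearMap.lTensor_tmul, pi_eq_sum_univ' (F.d i p), TensorProduct.tmul_sum]
    refine Finset.sum_eq_zero fun j _ => ?_
    rw [TensorProduct.tmul_smul, TensorProduct.smul_tmul']
    have : F.d i p j • (⟨x, hx⟩ : K) = 0 :=
      Subtype.ext (smul_eq_zero_of_mem_coord hab (mem_coord.1 hla j) hxb)
    rw [this, TensorProduct.zero_tmul]
  obtain ⟨w, hw⟩ := (h _).1 hcycle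
  let φ : K ⊗[R] (Fin (F.r (i + 1)) → R) →ₗ[R] ResidueField R :=
    LinearMap.mul' R (ResidueField R) ∘ₗ TensorProduct.map f (g ∘ₗ (F.d i).rangeRestrict)
  have hφ : φ ∘ₗ (F.d (i + 1)).lTensor K = 0 := by
    refine TensorProduct.ext' fun y z => ?_
    have : (F.d i).rangeRestrict (F.d (i + 1) z) = 0 :=
      Subtype.ext ((F.exact_succ i).apply_apply_eq_zero z)
    change f y * g ((F.d i).rangeRestrict (F.d (i + 1) z)) = 0
    rw [this, map_zero, mul_zero]
  have h0 := LinearMap.congr_fun hφ w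
  rw [LinearMap.comp_apply, hw] at h0
  exact mul_ne_zero hf hg h0

/-- A free resolution is minimal if its differentials have entries in the maximal ideal. -/
def IsMinimal (F : FreeRes R M) : Prop :=
  ∀ i x j, F.d i x j ∈ maximalIdeal R

section Minimal

variable {F : FreeRes R M} (hF : F.IsMinimal)
include hF

lemma IsMinimal.syz_le (i : ℕ) : F.syz i ≤ coord (maximalIdeal R) (F.r i) := by
  rintro _ ⟨x, rfl⟩
  exact mem_coord.2 (hF i x)

lemma IsMinimal.syz_split {a b : Ideal R} (hab : a ⊓ b = ⊥) (hm : a ⊔ b = maximalIdeal R)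
    (i : ℕ) : F.syz (i + 1) ≤
      (F.syz (i + 1) ⊓ coord a (F.r (i + 1))) ⊔ (F.syz (i + 1) ⊓ coord b (F.r (i + 1))) := by
  have h := hF.syz_le (i + 1)
  rw [syz_succ] at h ⊢
  exact ker_le_split hab hm _ h

lemma IsMinimal.syz_eq_bot_of_socle {a : Ideal R} {s : R} (hs : s ≠ 0) (hsa : s ∈ a)
    (hsm : ∀ x ∈ maximalIdeal R, s * x = 0) {i : ℕ}
    (h : F.syz (i + 1) ⊓ coord a (F.r (i + 1)) = ⊥) : F.syz i = ⊥ := by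
  have key (p : Fin (F.r (i + 1)) → R) : s • p = 0 := by
    rw [← Submodule.mem_bot R, ← h, syz_succ]
    refine ⟨?_, mem_coord.2 fun j => a.mul_mem_right _ hsa⟩
    rw [SetLike.mem_coe, LinearMap.mem_ker, map_smul]
    ext j
    exact hsm _ (hF i p j)
  rw [eq_bot_iff]
  rintro _ ⟨p, rfl⟩
  have hp : p = 0 := by
    ext j
    exact (hs (by simpa using congrFun (key (fun _ => 1)) j)).elim
  rw [hp, map_zero]
  exact zero_mem _

lemma IsMinimal.free_of_syz_eq_bot {s : R} (hs : s ≠ 0)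
    (hsm : ∀ x ∈ maximalIdeal R, s * x = 0) {i : ℕ} (h : F.syz i = ⊥) : Module.Free R M := by
  induction i with
  | zero =>
    have hinj : Function.Injective F.ε := by
      rw [← LinearMap.ker_eq_bot, LinearMap.exact_iff.1 F.exact_zero]
      exact h
    exact Module.Free.of_equiv (LinearEquiv.ofBijective F.ε ⟨hinj, F.surj⟩)
  | succ i ih =>
    refine ih (hF.syz_eq_bot_of_socle (a := ⊤) hs trivial hsm ?_)
    rw [h, bot_inf_eq]

variable [IsNoetherianRing R]

lemma IsMinimal.inf_coord_eq_bot {a b : Ideal R} (hab : a ⊓ b = ⊥)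
    (hm : a ⊔ b = maximalIdeal R) (hb : b ≠ ⊥) {i : ℕ}
    (h : F.syz (i + 2) ⊓ coord b (F.r (i + 2)) = ⊥) :
    F.syz (i + 1) ⊓ coord a (F.r (i + 1)) = ⊥ := by
  refine inf_coord_eq_bot_of_le_smul hab (hF.syz_split hab hm i) ?_
  rintro _ ⟨⟨p, rfl⟩, hpa⟩
  refine map_mem_smul_of_mem_coord _ (mem_coord.2 fun j => ?_)
  by_contra hj
  obtain ⟨t, htb, ht⟩ := Submodule.exists_mem_ne_zero_of_ne_bot hb
  have htp : t • p = 0 := by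
    rw [← Submodule.mem_bot R, ← h, F.syz_succ]
    refine ⟨?_, mem_coord.2 fun j => b.mul_mem_right _ htb⟩
    rw [SetLike.mem_coe, LinearMap.mem_ker, map_smul]
    exact smul_eq_zero_of_mem_coord (inf_comm a b ▸ hab) htb hpa
  have hu : IsUnit (p j) := not_not.1 hj
  exact ht ((hu.mul_left_eq_zero).1 (congrFun htp j))

lemma IsMinimal.eq_bot_or_eq_bot {P : FreeRes R N} (hP : P.IsMinimal) {a b : Ideal R}
    (hab : a ⊓ b = ⊥) (hm : a ⊔ b = maximalIdeal R) {i j : ℕ}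
    (h : F.TorExact (P.syz (j + 1)) (i + 1)) :
    F.syz (i + 1) ⊓ coord a (F.r (i + 1)) = ⊥ ∨ P.syz (j + 1) ⊓ coord b (P.r (j + 1)) = ⊥ := by
  by_contra! hc
  have h1 : ¬ F.syz (i + 1) ⊓ coord a (F.r (i + 1)) ≤ maximalIdeal R • F.syz (i + 1) :=
    fun hle => hc.1 (inf_coord_eq_bot_of_le_smul hab (hF.syz_split hab hm i) hle)
  have h2 : ¬ P.syz (j + 1) ⊓ coord b (P.r (j + 1)) ≤ maximalIdeal R • P.syz (j + 1) :=
    fun hle => hc.2 (inf_coord_eq_bot_of_le_smul (inf_comm a b ▸ hab)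
      (hP.syz_split (inf_comm a b ▸ hab) (sup_comm a b ▸ hm) j) hle)
  obtain ⟨l, hl, hl'⟩ := SetLike.not_le_iff_exists.1 h1
  obtain ⟨x, hx, hx'⟩ := SetLike.not_le_iff_exists.1 h2
  exact (h.mem_or_mem hab hx.1 hx.2 hl.1 hl.2).elim hx' hl'

theorem IsMinimal.free_or_free {P : FreeRes R N} (hP : P.IsMinimal) {a b : Ideal R}
    (hab : a ⊓ b = ⊥) (hm : a ⊔ b = maximalIdeal R) (hb : b ≠ ⊥) {s : R} (hs : s ≠ 0)
    (hsa : s ∈ a) (hsm : ∀ x ∈ maximalIdeal R, s * x = 0) {i : ℕ} (h : F.TorExact N (i + 4)) :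
    Module.Free R M ∨ Module.Free R N := by
  by_contra! hc
  have h2 : F.TorExact (P.syz 2) (i + 1) := ((h.syz_zero P).syz_succ P).syz_succ P
  rcases hF.eq_bot_or_eq_bot hP hab hm h2 with h3 | h3
  · exact hc.1 (hF.free_of_syz_eq_bot hs hsm (hF.syz_eq_bot_of_socle hs hsa hsm h3))
  · exact hc.2 (hP.free_of_syz_eq_bot hs hsm
      (hP.syz_eq_bot_of_socle hs hsa hsm (hP.inf_coord_eq_bot hab hm hb h3)))

lemma IsMinimal.syz_eq_bot_of_subsingleton_ext {i : ℕ}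
    (h : ∀ X : ModuleCat R, Subsingleton
      (((Ext R (ModuleCat R) (i + 1)).obj (op (ModuleCat.of R M))).obj X)) : F.syz i = ⊥ := by
  obtain ⟨g, hg⟩ : ∃ g : (Fin (F.r i) → R) →ₗ[R] F.syz i, (F.d i).rangeRestrict = g ∘ₗ F.d i :=
    F.exists_factor_of_extZero (F.syz i) i (h _) (F.d i).rangeRestrict <|
      LinearMap.ext fun x => Subtype.ext ((F.exact_succ i).apply_apply_eq_zero x)
  refine eq_bot_of_le_smul ?_
  rintro _ ⟨p, rfl⟩
  have hp := map_mem_smul_of_mem_coord ((F.syz i).subtype ∘ₗ g) (mem_coord.2 (hF i p))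
  have hgp : (F.syz i).subtype (g (F.d i p)) = F.d i p :=
    congrArg Subtype.val (LinearMap.congr_fun hg p).symm
  rw [LinearMap.comp_apply, hgp] at hp
  have hle : LinearMap.range ((F.syz i).subtype ∘ₗ g) ≤ F.syz i := by
    rintro _ ⟨y, rfl⟩
    exact (g y).2
  exact smul_mono_right (maximalIdeal R) hle hp

end Minimal

end FreeRes

section Fiber

variable {S T k : Type} [CommRing S] [CommRing T] [Field k]
  (πS : S →+* k) (πT : T →+* k)

/-- The projection of the fiber product onto the first factor. -/
def fiberFst : fiberProd πS πT →+* S := (RingHom.fst S T).comp (fiberProd πS πT).subtype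

/-- The projection of the fiber product onto the second factor. -/
def fiberSnd : fiberProd πS πT →+* T := (RingHom.snd S T).comp (fiberProd πS πT).subtype

lemma fiberProd_ext {x y : fiberProd πS πT} (h : fiberFst πS πT x = fiberFst πS πT y)
    (h' : fiberSnd πS πT x = fiberSnd πS πT y) : x = y :=
  Subtype.ext (Prod.ext h h')

lemma exists_fiberProd (s : S) (t : T) (h : πS s = πT t) :
    ∃ x, fiberFst πS πT x = s ∧ fiberSnd πS πT x = t :=
  ⟨⟨(s, t), h⟩, rfl, rfl⟩

lemma fiberProd_condition (x : fiberProd πS πT) :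
    πS (fiberFst πS πT x) = πT (fiberSnd πS πT x) :=
  x.2

lemma ker_fiberSnd_inf_ker_fiberFst :
    RingHom.ker (fiberSnd πS πT) ⊓ RingHom.ker (fiberFst πS πT) = ⊥ := by
  rw [eq_bot_iff]
  rintro x ⟨h1, h2⟩
  exact fiberProd_ext πS πT (h2.trans (map_zero _).symm) (h1.trans (map_zero _).symm)

variable {πS πT}

lemma fiberFst_surjective (hπT : Function.Surjective πT) :
    Function.Surjective (fiberFst πS πT) := fun s =>
  let ⟨t, ht⟩ := hπT (πS s)
  let ⟨x, hx, _⟩ := exists_fiberProd πS πT s t ht.symm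
  ⟨x, hx⟩

lemma fiberSnd_surjective (hπS : Function.Surjective πS) :
    Function.Surjective (fiberSnd πS πT) := fun t =>
  let ⟨s, hs⟩ := hπS (πT t)
  let ⟨x, _, hx⟩ := exists_fiberProd πS πT s t hs
  ⟨x, hx⟩

lemma isNoetherianRing_fiberProd [IsNoetherianRing S] [IsNoetherianRing T]
    (hπS : Function.Surjective πS) (hπT : Function.Surjective πT) :
    IsNoetherianRing (fiberProd πS πT) := by
  let _ : Module (fiberProd πS πT) S := Module.compHom S (fiberFst πS πT)
  let _ : Module (fiberProd πS πT) T := Module.compHom T (fiberSnd πS πT)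
  have : RingHomSurjective (fiberFst πS πT) := ⟨fiberFst_surjective hπT⟩
  have : RingHomSurjective (fiberSnd πS πT) := ⟨fiberSnd_surjective hπS⟩
  let eS : S →ₛₗ[fiberFst πS πT] S := { AddMonoidHom.id S with map_smul' := fun _ _ => rfl }
  let eT : T →ₛₗ[fiberSnd πS πT] T := { AddMonoidHom.id T with map_smul' := fun _ _ => rfl }
  have : IsNoetherian (fiberProd πS πT) S :=
    (LinearMap.isNoetherian_iff_of_bijective eS Function.bijective_id).2 inferInstance
  have : IsNoetherian (fiberProd πS πT) T :=
    (LinearMap.isNoetherian_iff_of_bijective eT Function.bijective_id).2 inferInstance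
  let i : fiberProd πS πT →ₗ[fiberProd πS πT] S × T :=
    { (fiberProd πS πT).subtype.toAddMonoidHom with map_smul' := fun _ _ => rfl }
  exact isNoetherian_of_injective i Subtype.val_injective

lemma isLocalHom_fiberFst [IsLocalRing T] (hkT : RingHom.ker πT = maximalIdeal T) :
    IsLocalHom (fiberFst πS πT) where
  map_nonunit x hx := by
    have hne : πT (fiberSnd πS πT x) ≠ 0 := by
      rw [← fiberProd_condition]
      exact (hx.map πS).ne_zero
    have hx2 : IsUnit (fiberSnd πS πT x) := by
      by_contra h
      exact hne (hkT.ge h)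
    obtain ⟨s, hs⟩ := hx.exists_right_inv
    obtain ⟨t, ht⟩ := hx2.exists_right_inv
    obtain ⟨y, hy1, hy2⟩ := exists_fiberProd πS πT s t (by
      have h1 := congrArg πS hs
      have h2 := congrArg πT ht
      rw [map_mul, map_one] at h1 h2
      rw [fiberProd_condition] at h1
      exact mul_left_cancel₀ hne (h1.trans h2.symm))
    refine IsUnit.of_mul_eq_one y (fiberProd_ext πS πT ?_ ?_)
    · rw [map_mul, map_one, hy1, hs]
    · rw [map_mul, map_one, hy2, ht]

lemma isLocalRing_fiberProd [IsLocalRing S] [IsLocalRing T]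
    (hkT : RingHom.ker πT = maximalIdeal T) :
    IsLocalRing (fiberProd πS πT) :=
  have := isLocalHom_fiberFst (πS := πS) hkT
  RingHom.domain_isLocalRing (fiberFst πS πT)

lemma mem_maximalIdeal_fiberProd_iff [IsLocalRing S] [IsLocalRing T] [IsLocalRing (fiberProd πS πT)]
    (hkT : RingHom.ker πT = maximalIdeal T) {x : fiberProd πS πT} :
    x ∈ maximalIdeal (fiberProd πS πT) ↔ fiberFst πS πT x ∈ maximalIdeal S := by
  have := isLocalHom_fiberFst (πS := πS) hkT
  exact not_congr (isUnit_map_iff (fiberFst πS πT) x).symm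

lemma mem_maximalIdeal_fiberProd_iff_fiberSnd [IsLocalRing S] [IsLocalRing T]
    [IsLocalRing (fiberProd πS πT)]
    (hkS : RingHom.ker πS = maximalIdeal S) (hkT : RingHom.ker πT = maximalIdeal T)
    {x : fiberProd πS πT} :
    x ∈ maximalIdeal (fiberProd πS πT) ↔ fiberSnd πS πT x ∈ maximalIdeal T := by
  rw [mem_maximalIdeal_fiberProd_iff hkT, ← hkS, ← hkT, RingHom.mem_ker, RingHom.mem_ker,
    fiberProd_condition]

lemma ker_fiberSnd_sup_ker_fiberFst [IsLocalRing S] [IsLocalRing T] [IsLocalRing (fiberProd πS πT)]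
    (hkS : RingHom.ker πS = maximalIdeal S) (hkT : RingHom.ker πT = maximalIdeal T) :
    RingHom.ker (fiberSnd πS πT) ⊔ RingHom.ker (fiberFst πS πT) =
      maximalIdeal (fiberProd πS πT) := by
  refine le_antisymm (sup_le (fun x hx => ?_) fun x hx => ?_) fun x hx => ?_
  · rw [mem_maximalIdeal_fiberProd_iff_fiberSnd hkS hkT, RingHom.mem_ker.1 hx]
    exact zero_mem _
  · rw [mem_maximalIdeal_fiberProd_iff hkT, RingHom.mem_ker.1 hx]
    exact zero_mem _
  · have h1 := hkS.ge ((mem_maximalIdeal_fiberProd_iff hkT).1 hx)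
    have h2 := hkT.ge ((mem_maximalIdeal_fiberProd_iff_fiberSnd hkS hkT).1 hx)
    obtain ⟨y, hy1, hy2⟩ := exists_fiberProd πS πT (fiberFst πS πT x) 0 (by
      rw [map_zero]; exact h1)
    obtain ⟨z, hz1, hz2⟩ := exists_fiberProd πS πT 0 (fiberSnd πS πT x) (by
      rw [map_zero]; exact h2.symm)
    refine Submodule.mem_sup.2 ⟨y, hy2, z, hz1, fiberProd_ext πS πT ?_ ?_⟩
    · rw [map_add, hy1, hz1, add_zero]
    · rw [map_add, hy2, hz2, zero_add]

lemma exists_mem_ker_fiberSnd [IsLocalRing S] (hkS : RingHom.ker πS = maximalIdeal S)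
    {s : S} (hs : s ∈ maximalIdeal S) :
    ∃ x ∈ RingHom.ker (fiberSnd πS πT), fiberFst πS πT x = s := by
  obtain ⟨x, hx1, hx2⟩ := exists_fiberProd πS πT s 0 (by
    rw [map_zero]; exact hkS.ge hs)
  exact ⟨x, hx2, hx1⟩

lemma exists_mem_ker_fiberFst [IsLocalRing T] (hkT : RingHom.ker πT = maximalIdeal T)
    {t : T} (ht : t ∈ maximalIdeal T) :
    ∃ x ∈ RingHom.ker (fiberFst πS πT), fiberSnd πS πT x = t := by
  obtain ⟨x, hx1, hx2⟩ := exists_fiberProd πS πT 0 t (by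
    rw [map_zero]; exact (hkT.ge ht).symm)
  exact ⟨x, hx1, hx2⟩

end Fiber

lemma exists_socle_mem_maximalIdeal {S : Type} [CommRing S] [IsLocalRing S]
    (hS : maximalIdeal S ≠ ⊥) (h : depthM S S = 0) :
    ∃ s ∈ maximalIdeal S, s ≠ 0 ∧ ∀ x ∈ maximalIdeal S, s * x = 0 := by
  obtain ⟨s, hs, hsx⟩ := exists_socle S h
  refine ⟨s, fun hu => hS ?_, hs, fun x hx => mul_comm x s ▸ hsx x hx⟩
  exact eq_bot_iff.2 fun x hx => (hu.mul_left_eq_zero).1 (hsx x hx)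

lemma ne_bot_of_map_ne_zero {R S : Type} [CommRing R] [CommRing S] (f : R →+* S) {I : Ideal R}
    {x : R} (hx : x ∈ I) (hf : f x ≠ 0) : I ≠ ⊥ := by
  rintro rfl
  exact hf (by rw [(Submodule.mem_bot R).1 hx, map_zero])

theorem tfae_of_socle {R : Type} [CommRing R] [IsLocalRing R] [IsNoetherianRing R] {a b : Ideal R}
    (hab : a ⊓ b = ⊥) (hm : a ⊔ b = maximalIdeal R) (hb : b ≠ ⊥) {s : R} (hs : s ≠ 0)
    (hsa : s ∈ a) (hsm : ∀ x ∈ maximalIdeal R, s * x = 0)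
    (M N : Type) [AddCommGroup M] [Module R M] [Module.Finite R M]
    [AddCommGroup N] [Module R N] [Module.Finite R N] :
    [ (∃ n : ℕ, ∀ i ≥ n, TorZero R M N i),
      (∀ i ≥ 1, TorZero R M N i),
      (∃ i ≥ 5, TorZero R M N i),
      ((∃ n, PdLE R M n) ∨ (∃ n, PdLE R N n)),
      (Module.Free R M ∨ Module.Free R N) ].TFAE := by
  have free_of_pdLE (X : Type) [AddCommGroup X] [Module R X] [Module.Finite R X]
      (h : ∃ n, PdLE R X n) : Module.Free R X := by
    obtain ⟨n, hn⟩ := h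
    have hF : (FreeRes.minimal R X).IsMinimal := FreeRes.minimal_apply_mem R X
    exact hF.free_of_syz_eq_bot hs hsm
      (hF.syz_eq_bot_of_subsingleton_ext fun Y => hn Y (n + 1) n.lt_succ_self)
  have pdLE_of_free (X : Type) [AddCommGroup X] [Module R X] [Module.Free R X] : PdLE R X 0 := by
    intro Y i hi
    obtain ⟨i, rfl⟩ := Nat.exists_eq_succ_of_ne_zero hi.ne'
    have : Projective (ModuleCat.of R X) :=
      ModuleCat.projective_of_free (Module.Free.chooseBasis R X)
    exact ModuleCat.isZero_iff_subsingleton.1 (isZero_Ext_succ_of_projective _ Y i)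
  tfae_have 2 → 1 := fun h => ⟨1, h⟩
  tfae_have 1 → 3 := fun ⟨n, h⟩ => ⟨max n 5, le_max_right _ _, h _ (le_max_left _ _)⟩
  tfae_have 3 → 5 := by
    rintro ⟨i, hi, h⟩
    obtain ⟨i, rfl⟩ := Nat.exists_eq_add_of_le' hi
    have hF : (FreeRes.minimal R N).IsMinimal := FreeRes.minimal_apply_mem R N
    exact (hF.free_or_free (FreeRes.minimal_apply_mem R M) hab hm hb hs hsa hsm
      (((FreeRes.minimal R N).torZero_succ_iff M (i + 4)).1 h)).symm
  tfae_have 5 → 4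
    | .inl _ => .inl ⟨0, pdLE_of_free M⟩
    | .inr _ => .inr ⟨0, pdLE_of_free N⟩
  tfae_have 4 → 5 := Or.imp (free_of_pdLE M) (free_of_pdLE N)
  tfae_have 5 → 2 := by
    rintro h i hi
    obtain ⟨i, rfl⟩ := Nat.exists_eq_add_of_le' hi
    rcases h with _ | _
    · exact ((FreeRes.minimal R N).torZero_succ_iff M i).2
        ((FreeRes.minimal R N).torExact_of_flat i)
    · have : Projective (ModuleCat.of R N) :=
        ModuleCat.projective_of_free (Module.Free.chooseBasis R N)
      exact ModuleCat.isZero_iff_subsingleton.1 (isZero_Tor_succ_of_projective (ModuleCat R) _ _ i)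
  tfae_finish

/-- Theorem 2.7: over a fiber product `R = S ×ₖ T` with `depth S = 0` or `depth T = 0`,
the five Tor-vanishing/projective-dimension/freeness conditions are equivalent. -/
theorem stmt_0 (S T k : Type) [CommRing S] [CommRing T] [Field k]
    [IsNoetherianRing S] [IsNoetherianRing T] [IsLocalRing S] [IsLocalRing T]
    (πS : S →+* k) (πT : T →+* k)
    (hπS : Function.Surjective πS) (hπT : Function.Surjective πT)
    (hkS : RingHom.ker πS = maximalIdeal S) (hkT : RingHom.ker πT = maximalIdeal T)
    (hS : maximalIdeal S ≠ ⊥) (hT : maximalIdeal T ≠ ⊥)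
    (hdepth : depthM S S = 0 ∨ depthM T T = 0)
    (M N : Type) [AddCommGroup M] [Module (fiberProd πS πT) M]
    [Module.Finite (fiberProd πS πT) M]
    [AddCommGroup N] [Module (fiberProd πS πT) N]
    [Module.Finite (fiberProd πS πT) N] :
    [ (∃ n : ℕ, ∀ i ≥ n, TorZero (fiberProd πS πT) M N i),
      (∀ i ≥ 1, TorZero (fiberProd πS πT) M N i),
      (∃ i ≥ 5, TorZero (fiberProd πS πT) M N i),
      ((∃ n, PdLE (fiberProd πS πT) M n) ∨ (∃ n, PdLE (fiberProd πS πT) N n)),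
      (Module.Free (fiberProd πS πT) M ∨ Module.Free (fiberProd πS πT) N) ].TFAE := by
  have := isLocalRing_fiberProd (πS := πS) hkT
  have := isNoetherianRing_fiberProd hπS hπT
  have hab := ker_fiberSnd_inf_ker_fiberFst πS πT
  have hm := ker_fiberSnd_sup_ker_fiberFst hkS hkT
  rcases hdepth with h | h
  · obtain ⟨s, hsm, hs, hsx⟩ := exists_socle_mem_maximalIdeal hS h
    obtain ⟨t, htm, ht⟩ := Submodule.exists_mem_ne_zero_of_ne_bot hT
    obtain ⟨x, hx, rfl⟩ := exists_mem_ker_fiberSnd (πT := πT) hkS hsm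
    obtain ⟨y, hy, rfl⟩ := exists_mem_ker_fiberFst (πS := πS) hkT htm
    refine tfae_of_socle hab hm (ne_bot_of_map_ne_zero _ hy ht)
      (ne_zero_of_map hs) hx (fun z hz => fiberProd_ext πS πT ?_ ?_) M N
    · rw [map_mul, map_zero, hsx _ ((mem_maximalIdeal_fiberProd_iff hkT).1 hz)]
    · rw [map_mul, map_zero, RingHom.mem_ker.1 hx, zero_mul]
  · obtain ⟨t, htm, ht, htx⟩ := exists_socle_mem_maximalIdeal hT h
    obtain ⟨s, hsm, hs⟩ := Submodule.exists_mem_ne_zero_of_ne_bot hS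
    obtain ⟨x, hx, rfl⟩ := exists_mem_ker_fiberSnd (πT := πT) hkS hsm
    obtain ⟨y, hy, rfl⟩ := exists_mem_ker_fiberFst (πS := πS) hkT htm
    refine tfae_of_socle (inf_comm _ _ |>.trans hab) (sup_comm _ _ |>.trans hm)
      (ne_bot_of_map_ne_zero _ hx hs)
      (ne_zero_of_map ht) hy (fun z hz => fiberProd_ext πS πT ?_ ?_) M N
    · rw [map_mul, map_zero, RingHom.mem_ker.1 hy, zero_mul]
    · rw [map_mul, map_zero, htx _ ((mem_maximalIdeal_fiberProd_iff_fiberSnd hkS hkT).1 hz)]
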